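/- Let E be the directed graph with vertices E⁰ = {v_n, w_n, p_n : n ≥ 1} ∪ {q_{n,m} : n ≥ 1, m ≥ 0} and edges: a_n with r(a_n) = v_n, s(a_n) = v_{n+1}; b_n with r(b_n) = w_n, s(b_n) = w_{n+1}; c_n with r(c_n) = v_n, s(c_n) = p_n; d_n with r(d_n) = w_n, s(d_n) = p_n; f_n^{(1)}, f_n^{(2)} with r(f_n^{(i)}) = p_n, s(f_n^{(i)}) = q_{n,0}; and h_{n,m} with r(h_{n,m}) = q_{n,m}, s(h_{n,m}) = q_{n,m+1}. For n ≥ 1 let x^{(n)} := a₁⋯a_{n−1} c_n f_n^{(1)} h_{n,0} h_{n,1} ⋯ ∈ E^∞, let x := a₁a₂a₃⋯ ∈ E^∞ and let y := b₁b₂b₃⋯ ∈ E^∞. Then the orbit space of the path groupoid G_E is not Hausdorff, and the sequence {x^{(n)}} converges 2-times in the orbit space to x and also converges 2-times in the orbit space to y. -/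

import Mathlib

open Filter Topology

/-- A directed graph: countable sets of vertices and edges with range and
source maps. -/
structure DirGraph where
  V : Type
  E : Type
  countV : Countable V
  countE : Countable E
  r : E → V
  s : E → V

/-- An infinite path in the directed graph `g` (edges indexed from `0`). -/
structure InfPath (g : DirGraph) where
  edge : ℕ → g.E
  chain : ∀ i, g.s (edge i) = g.r (edge (i + 1))

/-- `x ∼_k y`: the infinite paths `x` and `y` are shift equivalent with lag `k`,
i.e. `x_i = y_{i+k}` for all sufficiently large `i`. -/
def ShiftEquiv (g : DirGraph) (x y : InfPath g) (k : ℤ) : Prop :=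
  ∃ N : ℕ, 0 ≤ (N : ℤ) + k ∧ ∀ i : ℕ, N ≤ i → x.edge i = y.edge ((i : ℤ) + k).toNat

/-- The path groupoid `G_E = {(x,k,y) : x ∼_k y}` of the directed graph `g`. -/
structure PGpd (g : DirGraph) where
  xp : InfPath g
  lag : ℤ
  yp : InfPath g
  shift : ShiftEquiv g xp yp lag

/-- `α` is a (nonempty) finite path. -/
def IsFinPath (g : DirGraph) (α : List g.E) : Prop :=
  α ≠ [] ∧ List.Chain' (fun e f => g.s e = g.r f) α

/-- The cylinder set `Z(α)` of infinite paths extending the finite path `α`. -/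
def Cylinder (g : DirGraph) (α : List g.E) : Set (InfPath g) :=
  {x | ∀ (i : ℕ) (h : i < α.length), x.edge i = α.get ⟨i, h⟩}

/-- The topology on `E^∞` generated by the cylinder sets. -/
instance instTopInfPath (g : DirGraph) : TopologicalSpace (InfPath g) :=
  TopologicalSpace.generateFrom {S | ∃ α : List g.E, IsFinPath g α ∧ S = Cylinder g α}

/-- The basic set `Z(α,β)` in the path groupoid. -/
def ZSet (g : DirGraph) (α β : List g.E) : Set (PGpd g) :=
  {γ | γ.lag = (β.length : ℤ) - (α.length : ℤ) ∧
    (∀ (i : ℕ) (h : i < α.length), γ.xp.edge i = α.get ⟨i, h⟩) ∧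
    (∀ (i : ℕ) (h : i < β.length), γ.yp.edge i = β.get ⟨i, h⟩) ∧
    ∀ i : ℕ, α.length ≤ i →
      γ.xp.edge i = γ.yp.edge ((i : ℤ) + ((β.length : ℤ) - (α.length : ℤ))).toNat}

/-- The topology on the path groupoid generated by the sets `Z(α,β)` for finite
paths `α`, `β` with `s(α) = s(β)`. -/
instance instTopPGpd (g : DirGraph) : TopologicalSpace (PGpd g) :=
  TopologicalSpace.generateFrom
    {S | ∃ (α β : List g.E) (hα : IsFinPath g α) (hβ : IsFinPath g β),
      g.s (α.getLast hα.1) = g.s (β.getLast hβ.1) ∧ S = ZSet g α β}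

/-- A sequence in `G_E` tends to infinity if it eventually leaves every compact
subset of `G_E`. -/
def TendsToInftyG (g : DirGraph) (γ : ℕ → PGpd g) : Prop :=
  ∀ K : Set (PGpd g), IsCompact K → ∀ᶠ n in atTop, γ n ∉ K

/-- `{x_n}` converges `k`-times in the orbit space to `z`: there are `k` sequences
`γ^{(i)}` in `G_E` with `s(γ_n^{(i)}) = x_n`, `r(γ_n^{(i)}) → z`, and
`γ_n^{(j)}(γ_n^{(i)})⁻¹ = (r(γ_n^{(j)}), lag_j − lag_i, r(γ_n^{(i)}))` tending to
infinity for `i < j`. -/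
def ConvKTimes (g : DirGraph) (k : ℕ) (x : ℕ → InfPath g) (z : InfPath g) : Prop :=
  ∃ γ : Fin k → ℕ → PGpd g,
    (∀ i n, (γ i n).yp = x n) ∧
    (∀ i, Tendsto (fun n => (γ i n).xp) atTop (𝓝 z)) ∧
    ∀ i j : Fin k, i < j → ∃ d : ℕ → PGpd g,
      (∀ n, (d n).xp = (γ j n).xp ∧ (d n).lag = (γ j n).lag - (γ i n).lag ∧
        (d n).yp = (γ i n).xp) ∧
      TendsToInftyG g d

/-! ### The graph of Statement 16

Vertices: `v n = .inl (.inl n)`, `w n = .inl (.inr n)`, `p n = .inr (.inl n)`,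
`q n m = .inr (.inr (n, m))`.
Edges: `a n = .inl (.inl n)` with `r = v n`, `s = v (n+1)`;
`b n = .inl (.inr n)` with `r = w n`, `s = w (n+1)`;
`c n = .inr (.inl (.inl n))` with `r = v n`, `s = p n`;
`d n = .inr (.inl (.inr n))` with `r = w n`, `s = p n`;
`f n i = .inr (.inr (.inl (n, i)))` (`i : Fin 2`) with `r = p n`, `s = q n 0`;
`h n m = .inr (.inr (.inr (n, m)))` with `r = q n m`, `s = q n (m+1)`.
(Indices are `0`-based, corresponding to `n ≥ 1` in the paper.) -/

def g16 : DirGraph where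
  V := (ℕ ⊕ ℕ) ⊕ (ℕ ⊕ ℕ × ℕ)
  E := (ℕ ⊕ ℕ) ⊕ ((ℕ ⊕ ℕ) ⊕ (ℕ × Fin 2 ⊕ ℕ × ℕ))
  countV := inferInstance
  countE := inferInstance
  r := fun e => match e with
    | .inl (.inl n) => .inl (.inl n)
    | .inl (.inr n) => .inl (.inr n)
    | .inr (.inl (.inl n)) => .inl (.inl n)
    | .inr (.inl (.inr n)) => .inl (.inr n)
    | .inr (.inr (.inl (n, _))) => .inr (.inl n)
    | .inr (.inr (.inr (n, m))) => .inr (.inr (n, m))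
  s := fun e => match e with
    | .inl (.inl n) => .inl (.inl (n + 1))
    | .inl (.inr n) => .inl (.inr (n + 1))
    | .inr (.inl (.inl n)) => .inr (.inl n)
    | .inr (.inl (.inr n)) => .inr (.inl n)
    | .inr (.inr (.inl (n, _))) => .inr (.inr (n, 0))
    | .inr (.inr (.inr (n, m))) => .inr (.inr (n, m + 1))

/-- The edges of the infinite path
`x⁽ⁿ⁾ = a₀⋯a_{n-1} c_n f_n⁽¹⁾ h_{n,0} h_{n,1} ⋯`. -/
def x16edge (n i : ℕ) : g16.E :=
  if i < n then Sum.inl (Sum.inl i)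
  else if i = n then Sum.inr (Sum.inl (Sum.inl n))
  else if i = n + 1 then Sum.inr (Sum.inr (Sum.inl (n, 0)))
  else Sum.inr (Sum.inr (Sum.inr (n, i - n - 2)))

/-- The infinite path `x⁽ⁿ⁾ = a₀⋯a_{n-1} c_n f_n⁽¹⁾ h_{n,0} h_{n,1} ⋯`. -/
def x16 (n : ℕ) : InfPath g16 where
  edge := x16edge n
  chain := by
    intro i
    unfold x16edge
    rcases lt_trichotomy (i + 1) n with h1 | h1 | h1
    · have h2 : i < n := by omega
      have h3 : ¬ i + 1 = n := by omega
      have h4 : ¬ i + 1 = n + 1 := by omega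
      simp [g16, h1, h2, h3, h4]
    · have h2 : i < n := by omega
      simp [g16, h1, h2]
    · have h2 : ¬ i + 1 < n := by omega
      have h3 : ¬ i + 1 = n := by omega
      by_cases h4 : i = n
      · have h5 : ¬ i < n := by omega
        have h6 : i + 1 = n + 1 := by omega
        simp [g16, h2, h3, h4, h5, h6]
      · by_cases h5 : i = n + 1
        · subst h5
          have h6 : ¬ (n + 1 < n) := by omega
          have h7 : ¬ (n + 1 + 1 < n) := by omega
          have h8 : ¬ (n + 1 + 1 = n) := by omega
          have h9 : ¬ (n + 1 = n) := by omega
          have h10 : n + 1 + 1 - n - 2 = 0 := by omega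
          simp [g16, h6, h7, h8, h9, h10]
        · have h6 : ¬ i < n := by omega
          have h7 : ¬ i + 1 = n + 1 := by omega
          have h8 : i + 1 - n - 2 = (i - n - 2) + 1 := by omega
          simp [g16, h2, h3, h4, h5, h6, h7, h8]

/-- The infinite path `x = a₀a₁a₂⋯`. -/
def xinf16 : InfPath g16 where
  edge := fun i => Sum.inl (Sum.inl i)
  chain := fun _ => rfl

/-- The infinite path `y = b₀b₁b₂⋯`. -/
def yinf16 : InfPath g16 where
  edge := fun i => Sum.inl (Sum.inr i)
  chain := fun _ => rfl

/-- The orbit equivalence on `E^∞`: `x ≈ y` iff `x ∼_k y` for some `k ∈ ℤ`. -/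
def orbRel (g : DirGraph) (x y : InfPath g) : Prop :=
  ∃ k : ℤ, ShiftEquiv g x y k

/-- The infinite path which follows the `a`-spine (`b = true`) or the `b`-spine (`b = false`)
up to index `n` and then continues through `p n`, the edge `f n j` and the `h`-tail. -/
def branchPath (b : Bool) (j : Fin 2) (n : ℕ) : InfPath g16 where
  edge i :=
    if i < n then Sum.inl (cond b (Sum.inl i) (Sum.inr i))
    else if i = n then Sum.inr (Sum.inl (cond b (Sum.inl n) (Sum.inr n)))
    else if i = n + 1 then Sum.inr (Sum.inr (Sum.inl (n, j)))
    else Sum.inr (Sum.inr (Sum.inr (n, i - n - 2)))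
  chain i := by
    obtain h | h | h | ⟨m, rfl⟩ :
        i + 1 < n ∨ i + 1 = n ∨ i = n ∨ ∃ m, i = n + 1 + m := by
      rcases lt_or_ge n i with h | h
      · exact Or.inr (Or.inr (Or.inr ⟨i - (n + 1), by omega⟩))
      · omega
    · have h2 : i < n := by omega
      cases b <;> simp [g16, h, h2]
    · subst h
      cases b <;> simp [g16]
    · subst h
      cases b <;> simp [g16]
    · have h1 : ¬ n + 1 + m < n := by omega
      have h2 : ¬ n + 1 + m + 1 < n := by omega
      have h3 : ¬ n + 1 + m = n := by omega
      have h4 : ¬ n + 1 + m + 1 = n := by omega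
      have h5 : n + 1 + m + 1 - n - 2 = m := by omega
      rcases m with _ | m
      · have h6 : n + 1 + 1 - n - 2 = 0 := by omega
        have h7 : ¬ n + 1 + 1 < n := by omega
        have h8 : ¬ n + 1 + 1 = n := by omega
        simp [g16, h6, h7, h8]
      · have h6 : n + 1 + (m + 1) - n - 2 = m := by omega
        simp [g16, h1, h2, h3, h4, h5, h6]

/-- The spine `a₀a₁a₂⋯` (`b = true`) or `b₀b₁b₂⋯` (`b = false`). -/
def spine (b : Bool) : InfPath g16 := cond b xinf16 yinf16

lemma spine_edge (b : Bool) (i : ℕ) :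
    (spine b).edge i = Sum.inl (cond b (Sum.inl i) (Sum.inr i)) := by
  cases b <;> rfl

lemma branchPath_edge_of_lt (b : Bool) (j : Fin 2) {n i : ℕ} (h : i < n) :
    (branchPath b j n).edge i = (spine b).edge i :=
  (if_pos h).trans (spine_edge b i).symm

lemma branchPath_edge_succ (b : Bool) (j : Fin 2) (n : ℕ) :
    (branchPath b j n).edge (n + 1) = Sum.inr (Sum.inr (Sum.inl (n, j))) :=
  (if_neg (by omega)).trans ((if_neg (by omega)).trans (if_pos rfl))

lemma branchPath_edge_of_le (b : Bool) (j : Fin 2) {n i : ℕ} (h : n + 2 ≤ i) :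
    (branchPath b j n).edge i = Sum.inr (Sum.inr (Sum.inr (n, i - n - 2))) :=
  (if_neg (by omega)).trans ((if_neg (by omega)).trans (if_neg (by omega)))

lemma shiftEquiv_branchPath (b b' : Bool) (j j' : Fin 2) (n : ℕ) :
    ShiftEquiv g16 (branchPath b j n) (branchPath b' j' n) 0 := by
  refine ⟨n + 2, by omega, fun i hi => ?_⟩
  simp only [add_zero, Int.toNat_natCast, branchPath_edge_of_le _ _ hi]
  rfl

lemma tendsto_branchPath (b : Bool) (j : Fin 2) :
    Tendsto (branchPath b j) atTop (𝓝 (spine b)) := by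
  refine TopologicalSpace.tendsto_nhds_generateFrom_iff.2 ?_
  rintro S ⟨α, -, rfl⟩ hz
  filter_upwards [eventually_ge_atTop α.length] with n hn i hi
  rw [branchPath_edge_of_lt b j (lt_of_lt_of_le hi hn)]
  exact hz i hi

lemma isFinPath_ofFn {g : DirGraph} (x : InfPath g) (N : ℕ) :
    IsFinPath g (List.ofFn fun i : Fin (N + 1) => x.edge i) := by
  refine ⟨by simp, ?_⟩
  rw [List.Chain', List.isChain_iff_getElem]
  intro i hi
  simpa [-List.ofFn_succ] using x.chain i

/-- Every element of the path groupoid lies in a basic open set `Z(α,β)`. -/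
lemma exists_isOpen_zSet {g : DirGraph} (γ : PGpd g) :
    ∃ α β : List g.E, IsOpen (ZSet g α β) ∧ γ ∈ ZSet g α β := by
  obtain ⟨N, hN, h⟩ := γ.shift
  obtain ⟨M, hM⟩ : ∃ M : ℕ, (M : ℤ) = N + γ.lag := ⟨(N + γ.lag).toNat, by omega⟩
  have hlag : ((M + 1 : ℕ) : ℤ) - ((N + 1 : ℕ) : ℤ) = γ.lag := by push_cast; omega
  refine ⟨List.ofFn fun i : Fin (N + 1) => γ.xp.edge i,
    List.ofFn fun i : Fin (M + 1) => γ.yp.edge i,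
    TopologicalSpace.isOpen_generateFrom_of_mem
      ⟨_, _, isFinPath_ofFn _ _, isFinPath_ofFn _ _, ?_, rfl⟩, ?_⟩
  · have hx := h (N + 1) (by omega)
    have e : (((N + 1 : ℕ) : ℤ) + γ.lag).toNat = M + 1 := by push_cast; omega
    rw [e] at hx
    simp only [List.getLast_ofFn]
    simpa [γ.xp.chain, γ.yp.chain] using congrArg g.r hx
  · simp only [ZSet, Set.mem_ofPred_eq, List.length_ofFn, hlag]
    refine ⟨trivial, fun i hi => by simp [-List.ofFn_succ],
      fun i hi => by simp [-List.ofFn_succ], fun i hi => h i (by omega)⟩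

/-- Elements of lag zero whose range and source differ at positions tending to infinity
tend to infinity in the path groupoid. -/
lemma tendsToInftyG_of_edge_ne {g : DirGraph} {γ : ℕ → PGpd g} {p : ℕ → ℕ}
    (hp : Tendsto p atTop atTop) (hlag : ∀ n, (γ n).lag = 0)
    (hne : ∀ n, (γ n).xp.edge (p n) ≠ (γ n).yp.edge (p n)) : TendsToInftyG g γ := by
  intro K hK
  refine hK.induction_on (p := fun s => ∀ᶠ n in atTop, γ n ∉ s) (by simp)
    (fun s t hst ht => ht.mono fun n hn hs => hn (hst hs))
    (fun s t hs ht => by filter_upwards [hs, ht] with n h1 h2 using by simp [h1, h2]) ?_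
  intro δ _
  obtain ⟨α, β, hopen, hmem⟩ := exists_isOpen_zSet δ
  refine ⟨_, mem_nhdsWithin_of_mem_nhds (hopen.mem_nhds hmem), ?_⟩
  filter_upwards [hp.eventually_ge_atTop α.length] with n hn hγ
  obtain ⟨h1, -, -, h2⟩ := hγ
  rw [hlag] at h1
  have := h2 _ hn
  rw [← h1] at this
  exact hne n (by simpa using this)

lemma convKTimes_spine (b : Bool) : ConvKTimes g16 2 x16 (spine b) := by
  refine ⟨fun j n => ⟨branchPath b j n, 0, x16 n, shiftEquiv_branchPath b true j 0 n⟩,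
    fun _ _ => rfl, fun j => tendsto_branchPath b j, fun i j hij =>
      ⟨fun n => ⟨branchPath b j n, 0, branchPath b i n, shiftEquiv_branchPath b b j i n⟩,
        fun n => ⟨rfl, by simp, rfl⟩, ?_⟩⟩
  refine tendsToInftyG_of_edge_ne (tendsto_add_atTop_nat 1) (fun _ => rfl) fun n => ?_
  simp only [branchPath_edge_succ]
  simpa [g16] using hij.ne'

/-- Lying eventually in a given set of edges is an invariant of the orbit. -/
lemma eventually_edge_mem_iff_of_orbRel {g : DirGraph} (S : Set g.E) {x y : InfPath g}
    (h : orbRel g x y) :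
    (∀ᶠ i in atTop, x.edge i ∈ S) ↔ ∀ᶠ i in atTop, y.edge i ∈ S := by
  obtain ⟨k, N, hN, h⟩ := h
  simp only [eventually_atTop]
  constructor
  · rintro ⟨M, hM⟩
    refine ⟨((max M N : ℕ) + k).toNat, fun i hi => ?_⟩
    have e := h ((i : ℤ) - k).toNat (by omega)
    have e' : (((((i : ℤ) - k).toNat : ℕ) : ℤ) + k).toNat = i := by omega
    rw [e'] at e
    exact e ▸ hM _ (by omega)
  · rintro ⟨M, hM⟩
    refine ⟨max N ((M : ℤ) - k).toNat, fun i hi => ?_⟩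
    rw [h i (by omega)]
    exact hM _ (by omega)

lemma quot_mk_xinf16_ne : Quot.mk (orbRel g16) xinf16 ≠ Quot.mk (orbRel g16) yinf16 := by
  intro h
  let S : Set g16.E := Set.range fun n => Sum.inl (Sum.inl n)
  have h' := congrArg (Quot.lift (fun x : InfPath g16 => ∀ᶠ i in atTop, x.edge i ∈ S)
    fun _ _ hxy => propext (eventually_edge_mem_iff_of_orbRel S hxy)) h
  have hx : ∀ᶠ i in atTop, xinf16.edge i ∈ S := Eventually.of_forall fun i => ⟨i, rfl⟩
  obtain ⟨i, n, hn⟩ := (cast h' hx : ∀ᶠ i in atTop, yinf16.edge i ∈ S).exists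
  exact Sum.inl_ne_inr (Sum.inl_injective hn)

lemma not_t2Space_orbitSpace : ¬ T2Space (Quot (orbRel g16)) := by
  intro _
  have hlim (b : Bool) : Tendsto (fun n => Quot.mk (orbRel g16) (branchPath b 0 n)) atTop
      (𝓝 (Quot.mk (orbRel g16) (spine b))) :=
    (continuous_quot_mk.tendsto _).comp (tendsto_branchPath b 0)
  refine quot_mk_xinf16_ne (tendsto_nhds_unique (hlim true) ?_)
  refine (hlim false).congr fun n => Quot.sound ⟨0, shiftEquiv_branchPath _ _ _ _ n⟩

/-- For the graph above, the orbit space of the path groupoid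
is not Hausdorff, and the sequence `{x⁽ⁿ⁾}` converges `2`-times in the orbit
space to `x` and also converges `2`-times in the orbit space to `y`. -/
theorem x16_two_times_two_limits :
    ¬ T2Space (Quot (orbRel g16)) ∧
      ConvKTimes g16 2 x16 xinf16 ∧ ConvKTimes g16 2 x16 yinf16 := by
  exact ⟨not_t2Space_orbitSpace, convKTimes_spine true, convKTimes_spine false⟩
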